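/- Let d, e, f be natural numbers with e > 0, and let w₁ and w₂ be positive words in the letters x and y which together contain exactly d occurrences of x and f occurrences of y. Then the word w = w₁ τ x^e τ w₂ over X_H is geodesic (i.e., its weighted length d + e + f + 4 equals ℓ of its evaluation x^d (x^τ)^e y^f) if and only if e > d. -/

import Mathlib

/-! Generators and presentations for the groups `H` and `G` of Neumann–Shapiro. -/

inductive GenH : Type
  | x | y | t | tau
  deriving DecidableEq

inductive GenG : Type
  | x | y | s | t
  deriving DecidableEq

namespace NS

open FreeGroup

/-- Conjugation `a^b = b⁻¹ a b` in a group. -/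
def cnj {Γ : Type*} [Group Γ] (a b : Γ) : Γ := b⁻¹ * a * b

/-! ### The group `H` -/

abbrev FH := FreeGroup GenH

def fx : FH := FreeGroup.of GenH.x
def fy : FH := FreeGroup.of GenH.y
def ft : FH := FreeGroup.of GenH.t
def ftau : FH := FreeGroup.of GenH.tau

/-- The eight elements `x, x^t, x^τ, x^{tτ}, y, y^t, y^τ, y^{tτ}` (as words). -/
def basisH : List FH :=
  [fx, cnj fx ft, cnj fx ftau, cnj fx (ft * ftau),
   fy, cnj fy ft, cnj fy ftau, cnj fy (ft * ftau)]

/-- Relators of `H`: `t² = τ² = [τ,t] = 1`, the eight elements of `basisH` pairwise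
commute, and `x · x^τ = y · y^t`. -/
def relsH : Set FH :=
  {ft ^ 2, ftau ^ 2, ftau⁻¹ * ft⁻¹ * ftau * ft} ∪
    {r | ∃ a ∈ basisH, ∃ b ∈ basisH, r = a * b * a⁻¹ * b⁻¹} ∪
    {fx * cnj fx ftau * (fy * cnj fy ft)⁻¹}

abbrev H := PresentedGroup relsH

def Hx : H := PresentedGroup.of GenH.x
def Hy : H := PresentedGroup.of GenH.y
def Ht : H := PresentedGroup.of GenH.t
def Htau : H := PresentedGroup.of GenH.tau

/-! ### The group `G` -/

abbrev FG := FreeGroup GenG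

def gx : FG := FreeGroup.of GenG.x
def gy : FG := FreeGroup.of GenG.y
def gs : FG := FreeGroup.of GenG.s
def gt : FG := FreeGroup.of GenG.t

/-- The eight conjugating elements `1, s, s², s³, t, ts, ts², ts³`. -/
def conjsG : List FG := [1, gs, gs ^ 2, gs ^ 3, gt, gt * gs, gt * gs ^ 2, gt * gs ^ 3]

/-- The sixteen elements `x^α, y^α` for `α ∈ {1, s, s², s³, t, ts, ts², ts³}`. -/
def basisG : List FG :=
  conjsG.map (fun b => cnj gx b) ++ conjsG.map (fun b => cnj gy b)

/-- Relators of `G`: `t² = s⁴ = [s,t] = 1`, the sixteen elements of `basisG` pairwise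
commute, and `x · x^{s²} = y · y^t`. -/
def relsG : Set FG :=
  {gt ^ 2, gs ^ 4, gs⁻¹ * gt⁻¹ * gs * gt} ∪
    {r | ∃ a ∈ basisG, ∃ b ∈ basisG, r = a * b * a⁻¹ * b⁻¹} ∪
    {gx * cnj gx (gs ^ 2) * (gy * cnj gy gt)⁻¹}

abbrev G := PresentedGroup relsG

def Gx : G := PresentedGroup.of GenG.x
def Gy : G := PresentedGroup.of GenG.y
def Gs : G := PresentedGroup.of GenG.s
def Gt : G := PresentedGroup.of GenG.t

/-! ### Words, evaluation, lengths, geodesics -/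

/-- A word over the symmetric alphabet on `α`: a letter `(a, true)` stands for the
generator `a` and `(a, false)` for its inverse. -/
abbrev Word (α : Type) := List (α × Bool)

/-- Evaluate a word in a group, given the images of the generators. -/
def evalWith {α : Type} {Γ : Type*} [Group Γ] (f : α → Γ) (w : Word α) : Γ :=
  (w.map fun p => if p.2 then f p.1 else (f p.1)⁻¹).prod

/-- Evaluation of a word over `X_H = {x^{±1}, y^{±1}, t^{±1}, τ^{±1}}` in `H`. -/
def evalH : Word GenH → H := evalWith (fun a => (PresentedGroup.of a : H))

/-- Evaluation of a word over `X = {x^{±1}, y^{±1}, t^{±1}, s^{±1}}` in `G`. -/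
def evalG : Word GenG → G := evalWith (fun a => (PresentedGroup.of a : G))

/-- Weight of a letter for `H`: the letters `x^{±1}, y^{±1}, t^{±1}` have length `1`
and `τ^{±1}` has length `2`. -/
def wtH : GenH × Bool → ℕ
  | (GenH.tau, _) => 2
  | _ => 1

/-- Weighted length of a word over `X_H`. -/
def wlenH (w : Word GenH) : ℕ := (w.map wtH).sum

/-- `ℓ(h)`: the minimum weighted length of a word over `X_H` evaluating to `h`. -/
noncomputable def ellH (h : H) : ℕ := sInf {n | ∃ w : Word GenH, evalH w = h ∧ wlenH w = n}

/-- A word over `X_H` is geodesic if its weighted length is `ℓ` of its evaluation. -/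
def IsGeodesicH (w : Word GenH) : Prop := wlenH w = ellH (evalH w)

/-- `ℓ_G(g)`: the minimum length (number of letters) of a word over `X` evaluating to `g`. -/
noncomputable def ellG (g : G) : ℕ := sInf {n | ∃ w : Word GenG, evalG w = g ∧ w.length = n}

/-- A word over `X` is geodesic if its length is `ℓ_G` of its evaluation. -/
def IsGeodesicG (w : Word GenG) : Prop := w.length = ellG (evalG w)

end NS

namespace NS

/-- The translation of the last coordinate by an amount depending on the first two. -/
def shiftPerm (a : Bool → Bool → ℤ) : Equiv.Perm (Bool × Bool × ℤ) where
  toFun s := (s.1, s.2.1, s.2.2 + a s.1 s.2.1)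
  invFun s := (s.1, s.2.1, s.2.2 - a s.1 s.2.1)
  left_inv s := by simp
  right_inv s := by simp

def flipFst : Equiv.Perm (Bool × Bool × ℤ) where
  toFun s := (!s.1, s.2.1, s.2.2)
  invFun s := (!s.1, s.2.1, s.2.2)
  left_inv s := by simp
  right_inv s := by simp

def flipSnd : Equiv.Perm (Bool × Bool × ℤ) where
  toFun s := (s.1, !s.2.1, s.2.2)
  invFun s := (s.1, !s.2.1, s.2.2)
  left_inv s := by simp
  right_inv s := by simp

/-- The images of the generators of `H` acting on `Bool × Bool × ℤ`: `x` and `y` translate,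
`t` and `τ` flip the two Boolean coordinates. -/
def genPerm (a b : Bool → Bool → ℤ) : GenH → Equiv.Perm (Bool × Bool × ℤ)
  | GenH.x => shiftPerm a
  | GenH.y => shiftPerm b
  | GenH.t => flipFst
  | GenH.tau => flipSnd

theorem shiftPerm_apply (a i j n) : shiftPerm a (i, j, n) = (i, j, n + a i j) := rfl
theorem shiftPerm_symm_apply (a i j n) : (shiftPerm a).symm (i, j, n) = (i, j, n - a i j) := rfl
theorem flipFst_apply (i j n) : flipFst (i, j, n) = (!i, j, n) := rfl
theorem flipFst_symm_apply (i j n) : flipFst.symm (i, j, n) = (!i, j, n) := rfl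
theorem flipSnd_apply (i j n) : flipSnd (i, j, n) = (i, !j, n) := rfl
theorem flipSnd_symm_apply (i j n) : flipSnd.symm (i, j, n) = (i, !j, n) := rfl

theorem shiftPerm_commute (a b) : Commute (shiftPerm a) (shiftPerm b) := by
  ext ⟨i, j, n⟩ : 1
  simp [shiftPerm_apply, add_right_comm]

theorem exists_lift_eq_shiftPerm (a b : Bool → Bool → ℤ) (r : FH) (hr : r ∈ basisH) :
    ∃ c, FreeGroup.lift (genPerm a b) r = shiftPerm c := by
  have key (f : Bool → Bool → ℤ) :
      cnj (shiftPerm f) flipFst = shiftPerm (fun i j => f (!i) j) ∧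
      cnj (shiftPerm f) flipSnd = shiftPerm (fun i j => f i (!j)) ∧
      cnj (shiftPerm f) (flipFst * flipSnd) = shiftPerm (fun i j => f (!i) (!j)) := by
    refine ⟨?_, ?_, ?_⟩ <;> ext ⟨i, j, n⟩ : 1 <;>
      simp [cnj, shiftPerm_apply, flipFst_apply, flipFst_symm_apply, flipSnd_apply,
        flipSnd_symm_apply]
  have map_cnj (u v : FH) : FreeGroup.lift (genPerm a b) (cnj u v) =
      cnj (FreeGroup.lift (genPerm a b) u) (FreeGroup.lift (genPerm a b) v) := by
    simp [cnj]
  have hx : FreeGroup.lift (genPerm a b) fx = shiftPerm a := by simp [fx, genPerm]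
  have hy : FreeGroup.lift (genPerm a b) fy = shiftPerm b := by simp [fy, genPerm]
  have ht : FreeGroup.lift (genPerm a b) ft = flipFst := by simp [ft, genPerm]
  have htau : FreeGroup.lift (genPerm a b) ftau = flipSnd := by simp [ftau, genPerm]
  simp only [basisH, List.mem_cons, List.not_mem_nil, or_false] at hr
  rcases hr with rfl | rfl | rfl | rfl | rfl | rfl | rfl | rfl <;>
    simp only [map_cnj, map_mul, hx, hy, ht, htau, key] <;> exact ⟨_, rfl⟩

theorem lift_genPerm_eq_one (a b : Bool → Bool → ℤ)
    (hab : ∀ i j, a i j + a i (!j) = b i j + b (!i) j) :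
    ∀ r ∈ relsH, FreeGroup.lift (genPerm a b) r = 1 := by
  rintro r ((hr | ⟨u, hu, v, hv, rfl⟩) | rfl)
  · rcases hr with rfl | rfl | rfl <;> ext ⟨i, j, n⟩ : 1 <;>
      simp [ft, ftau, genPerm, pow_two, flipFst_apply, flipFst_symm_apply, flipSnd_apply,
        flipSnd_symm_apply]
  · obtain ⟨c, hc⟩ := exists_lift_eq_shiftPerm a b u hu
    obtain ⟨c', hc'⟩ := exists_lift_eq_shiftPerm a b v hv
    simp only [map_mul, map_inv, hc, hc']
    rw [(shiftPerm_commute c c').eq]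
    group
  · rw [map_mul, map_inv, mul_inv_eq_one]
    ext ⟨i, j, n⟩ : 1
    have := hab i j
    simp [cnj, fx, fy, ft, ftau, genPerm, shiftPerm_apply, flipFst_apply, flipFst_symm_apply,
      flipSnd_apply, flipSnd_symm_apply]
    linarith

/-- The action of `H` on `Bool × Bool × ℤ` determined by compatible weights. -/
def actH (a b : Bool → Bool → ℤ) (hab : ∀ i j, a i j + a i (!j) = b i j + b (!i) j) :
    H →* Equiv.Perm (Bool × Bool × ℤ) :=
  PresentedGroup.toGroup (lift_genPerm_eq_one a b hab)

theorem actH_of (a b hab) (g : GenH) :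
    actH a b hab (PresentedGroup.of g) = genPerm a b g :=
  PresentedGroup.toGroup.of _

theorem evalH_nil : evalH [] = 1 := rfl

theorem evalH_cons (p : GenH × Bool) (w : Word GenH) :
    evalH (p :: w) =
      (if p.2 then (PresentedGroup.of p.1 : H) else (PresentedGroup.of p.1)⁻¹) * evalH w := by
  simp [evalH, evalWith]

theorem evalH_append (v w : Word GenH) : evalH (v ++ w) = evalH v * evalH w := by
  simp [evalH, evalWith]

theorem evalH_replicate (n : ℕ) (g : GenH) :
    evalH (List.replicate n (g, true)) = (PresentedGroup.of g : H) ^ n := by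
  simp [evalH, evalWith]

theorem wlenH_cons (p : GenH × Bool) (w : Word GenH) : wlenH (p :: w) = wtH p + wlenH w := by
  simp [wlenH]

theorem wlenH_append (v w : Word GenH) : wlenH (v ++ w) = wlenH v + wlenH w := by
  simp [wlenH]

/-- If the weights are bounded by `1` on a set `S` of positions containing the origin and
closed under the flips occurring in `w`, then the translation part of `w` is bounded by the
number of letters `x^{±1}` and `y^{±1}` of `w`. -/
theorem actH_evalH_bound (a b hab) (S : Bool → Bool → Prop) (h0 : S false false)
    (ha : ∀ i j, S i j → |a i j| ≤ 1) (hb : ∀ i j, S i j → |b i j| ≤ 1) (w : Word GenH)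
    (ht : 0 < w.countP (·.1 = GenH.t) → ∀ i j, S i j → S (!i) j)
    (htau : 0 < w.countP (·.1 = GenH.tau) → ∀ i j, S i j → S i (!j)) :
    ∃ i j n, actH a b hab (evalH w) (false, false, 0) = (i, j, n) ∧ S i j ∧
      (i = true ↔ w.countP (·.1 = GenH.t) % 2 = 1) ∧
      (j = true ↔ w.countP (·.1 = GenH.tau) % 2 = 1) ∧
      |n| + w.countP (·.1 = GenH.t) + 2 * w.countP (·.1 = GenH.tau) ≤ wlenH w := by
  induction w with
  | nil => exact ⟨false, false, 0, by simp [evalH_nil], h0, by simp, by simp, by simp [wlenH]⟩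
  | cons p w ih =>
    obtain ⟨i, j, n, h, hS, hi, hj, hn⟩ := ih
      (fun h => ht (by rw [List.countP_cons]; omega))
      (fun h => htau (by rw [List.countP_cons]; omega))
    have ha' := abs_le.1 (ha i j hS)
    have hb' := abs_le.1 (hb i j hS)
    rw [evalH_cons, map_mul, Equiv.Perm.mul_apply, h, wlenH_cons]
    obtain ⟨_ | _ | _ | _, _ | _⟩ := p
    case x.false =>
      refine ⟨i, j, n - a i j, ?_, hS, by simpa using hi, by simpa using hj, ?_⟩
      · simp [actH_of, genPerm, shiftPerm_symm_apply]
      · simp [wtH]; grind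
    case x.true =>
      refine ⟨i, j, n + a i j, ?_, hS, by simpa using hi, by simpa using hj, ?_⟩
      · simp [actH_of, genPerm, shiftPerm_apply]
      · simp [wtH]; grind
    case y.false =>
      refine ⟨i, j, n - b i j, ?_, hS, by simpa using hi, by simpa using hj, ?_⟩
      · simp [actH_of, genPerm, shiftPerm_symm_apply]
      · simp [wtH]; grind
    case y.true =>
      refine ⟨i, j, n + b i j, ?_, hS, by simpa using hi, by simpa using hj, ?_⟩
      · simp [actH_of, genPerm, shiftPerm_apply]
      · simp [wtH]; grind
    case t.false | t.true =>
      refine ⟨!i, j, n, ?_, ht (by simp) i j hS, ?_, by simpa using hj, ?_⟩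
      · simp [actH_of, genPerm, flipFst_symm_apply, flipFst_apply]
      · simp; grind
      · simp [wtH]; grind
    case tau.false | tau.true =>
      refine ⟨i, !j, n, ?_, htau (by simp) i j hS, by simpa using hi, ?_, ?_⟩
      · simp [actH_of, genPerm, flipSnd_symm_apply, flipSnd_apply]
      · simp; grind
      · simp [wtH]; grind

theorem shiftPerm_pow_apply (a i j n) (k : ℕ) :
    (shiftPerm a ^ k) (i, j, n) = (i, j, n + k * a i j) := by
  induction k with
  | zero => simp
  | succ k ih =>
    rw [pow_succ', Equiv.Perm.mul_apply, ih, shiftPerm_apply]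
    push_cast
    ring_nf

theorem actH_normalForm (a b hab) (d e f : ℕ) :
    actH a b hab (Hx ^ d * (cnj Hx Htau) ^ e * Hy ^ f) (false, false, 0) =
      (false, false, d * a false false + e * a false true + f * b false false) := by
  have hc : cnj (shiftPerm a) flipSnd = shiftPerm (fun i j => a i (!j)) := by
    ext ⟨i, j, n⟩ : 1
    simp [cnj, shiftPerm_apply, flipSnd_apply, flipSnd_symm_apply]
  have hc' : actH a b hab (cnj Hx Htau) = shiftPerm (fun i j => a i (!j)) := by
    rw [← hc]
    simp [cnj, Hx, Htau, actH_of, genPerm]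
  simp only [map_mul, map_pow, hc', Equiv.Perm.mul_apply]
  simp only [Hx, Hy, actH_of, genPerm, shiftPerm_pow_apply, Bool.not_false, Prod.mk.injEq,
    true_and]
  ring

theorem le_wlenH_of_evalH_eq (d e f : ℕ) (hde : d < e) (w : Word GenH)
    (hw : evalH w = Hx ^ d * (cnj Hx Htau) ^ e * Hy ^ f) : d + e + f + 4 ≤ wlenH w := by
  rcases Nat.eq_zero_or_pos (w.countP (·.1 = GenH.tau)) with htau | htau
  · rcases Nat.eq_zero_or_pos (w.countP (·.1 = GenH.t)) with ht | ht
    · obtain ⟨i, j, n, h, -, hi, hj, hn⟩ := actH_evalH_bound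
        (fun i j => if i then (if j then 4 else 0) else (if j then 5 else -1))
        (fun i j => if j then 2 else (if i then 3 else 1)) (by decide)
        (fun i j => i = false ∧ j = false) (by simp) (by decide) (by decide) w
        (by omega) (by omega)
      rw [hw, actH_normalForm] at h
      simp only [Prod.mk.injEq] at h
      obtain ⟨rfl, rfl, rfl⟩ := h
      have h2 := le_abs_self (d * -1 + e * 5 + f * 1 : ℤ)
      simp at hn h2
      omega
    · obtain ⟨i, j, n, h, -, hi, hj, hn⟩ := actH_evalH_bound
        (fun i j => if i then 1 else (if j then 3 else -1))
        (fun _ _ => 1) (by decide)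
        (fun _ j => j = false) (by simp) (by decide) (by decide) w
        (by simp) (by omega)
      rw [hw, actH_normalForm] at h
      simp only [Prod.mk.injEq] at h
      obtain ⟨rfl, rfl, rfl⟩ := h
      have h2 := le_abs_self (d * -1 + e * 3 + f * 1 : ℤ)
      simp at hi hn h2
      omega
  · obtain ⟨i, j, n, h, -, hi, hj, hn⟩ := actH_evalH_bound
      (fun _ _ => 1) (fun _ _ => 1) (by decide)
      (fun _ _ => True) (by simp) (by decide) (by decide) w (by simp) (by simp)
    rw [hw, actH_normalForm] at h
    simp only [Prod.mk.injEq] at h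
    obtain ⟨rfl, rfl, rfl⟩ := h
    have h2 := le_abs_self ((d : ℤ) * 1 + e * 1 + f * 1)
    simp at hj hn h2
    omega

theorem mk_mul_self_of_sq_mem (g : FH) (hg : g ^ 2 ∈ relsH) :
    (PresentedGroup.mk relsH g) * PresentedGroup.mk relsH g = 1 := by
  rw [← map_mul, ← pow_two]
  exact PresentedGroup.one_of_mem hg

theorem Ht_mul_self : Ht * Ht = 1 :=
  mk_mul_self_of_sq_mem ft (by simp [relsH])

theorem Htau_mul_self : Htau * Htau = 1 :=
  mk_mul_self_of_sq_mem ftau (by simp [relsH])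

theorem mk_commute_of_mem_basisH {u v : FH} (hu : u ∈ basisH) (hv : v ∈ basisH) :
    Commute (PresentedGroup.mk relsH u) (PresentedGroup.mk relsH v) := by
  have h : PresentedGroup.mk relsH (u * v * u⁻¹ * v⁻¹) = 1 :=
    PresentedGroup.one_of_mem (Or.inl (Or.inr ⟨u, hu, v, hv, rfl⟩))
  rw [map_mul, map_inv, mul_inv_eq_one, map_mul, map_inv, mul_inv_eq_iff_eq_mul, map_mul] at h
  exact h

theorem Hx_commute_Hy : Commute Hx Hy :=
  mk_commute_of_mem_basisH (u := fx) (v := fy) (by simp [basisH]) (by simp [basisH])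

theorem Hx_commute_cnj : Commute Hx (cnj Hx Htau) :=
  mk_commute_of_mem_basisH (u := fx) (v := cnj fx ftau) (by simp [basisH]) (by simp [basisH])

theorem Hy_commute_cnj : Commute Hy (cnj Hx Htau) :=
  mk_commute_of_mem_basisH (u := fy) (v := cnj fx ftau) (by simp [basisH]) (by simp [basisH])

theorem Hy_commute_cnj_Hy : Commute Hy (cnj Hy Ht) :=
  mk_commute_of_mem_basisH (u := fy) (v := cnj fy ft) (by simp [basisH]) (by simp [basisH])

theorem Hx_mul_cnj : Hx * cnj Hx Htau = Hy * cnj Hy Ht := by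
  have h : PresentedGroup.mk relsH (fx * cnj fx ftau * (fy * cnj fy ft)⁻¹) = 1 :=
    PresentedGroup.one_of_mem (Or.inr rfl)
  rw [map_mul, map_inv, mul_inv_eq_one] at h
  exact h

theorem cnj_pow_eq {Γ : Type*} [Group Γ] (a b : Γ) (hb : b * b = 1) (n : ℕ) :
    b * a ^ n * b = cnj a b ^ n := by
  have hb' : b⁻¹ = b := inv_eq_of_mul_eq_one_left hb
  have := conj_pow (i := n) (a := b) (b := a)
  rw [hb'] at this
  rw [cnj, hb', this]

theorem evalH_positive (w : Word GenH)
    (h : ∀ p ∈ w, p = (GenH.x, true) ∨ p = (GenH.y, true)) :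
    evalH w = Hx ^ w.count (GenH.x, true) * Hy ^ w.count (GenH.y, true) ∧
      wlenH w = w.count (GenH.x, true) + w.count (GenH.y, true) := by
  induction w with
  | nil => simp [evalH_nil, wlenH]
  | cons p w ih =>
    obtain ⟨ih, ihl⟩ := ih fun p hp => h p (List.mem_cons_of_mem _ hp)
    rw [evalH_cons, ih, wlenH_cons, ihl]
    rcases h p List.mem_cons_self with rfl | rfl
    · simp only [List.count_cons_self, wtH]
      constructor
      · simp [Hx, pow_succ', mul_assoc]
      · simp; omega
    · simp only [List.count_cons_self, wtH]
      constructor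
      · have := (Hx_commute_Hy.pow_left (w.count (GenH.x, true))).eq
        simp only [if_true]
        rw [← Hy, ← mul_assoc, ← this, mul_assoc, ← pow_succ']
        simp
      · simp; omega

theorem isGeodesicH_iff (w : Word GenH) :
    IsGeodesicH w ↔ ∀ v, evalH v = evalH w → wlenH w ≤ wlenH v := by
  have hle (v : Word GenH) (hv : evalH v = evalH w) : ellH (evalH w) ≤ wlenH v :=
    Nat.sInf_le ⟨v, hv, rfl⟩
  constructor
  · intro h v hv
    exact h.trans_le (hle v hv)
  · intro h
    obtain ⟨v, hv, hvl⟩ := Nat.sInf_mem (s := {n | ∃ v, evalH v = evalH w ∧ wlenH v = n})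
      ⟨_, w, rfl, rfl⟩
    exact le_antisymm ((h v hv).trans_eq hvl) (hle w rfl)

/-- When `e ≤ d`, the element `x^d (x^τ)^e y^f` has a spelling that avoids `τ`. -/
theorem exists_evalH_eq_of_le (d e f : ℕ) (hde : e ≤ d) :
    ∃ v, evalH v = Hx ^ d * (cnj Hx Htau) ^ e * Hy ^ f ∧ wlenH v = d + e + f + 2 := by
  refine ⟨List.replicate (d - e) (GenH.x, true) ++ List.replicate e (GenH.y, true) ++
    [(GenH.t, true)] ++ List.replicate e (GenH.y, true) ++ [(GenH.t, true)] ++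
    List.replicate f (GenH.y, true), ?_, ?_⟩
  · simp only [evalH_append, evalH_replicate, evalH_cons, evalH_nil, if_true, mul_one]
    change Hx ^ (d - e) * Hy ^ e * Ht * Hy ^ e * Ht * Hy ^ f = _
    have h1 : Hx ^ (d - e) * Hy ^ e * Ht * Hy ^ e * Ht =
        Hx ^ (d - e) * (Hy ^ e * (Ht * Hy ^ e * Ht)) := by simp only [mul_assoc]
    rw [h1, cnj_pow_eq _ _ Ht_mul_self, ← Hy_commute_cnj_Hy.mul_pow, ← Hx_mul_cnj,
      Hx_commute_cnj.mul_pow, ← mul_assoc, ← pow_add, Nat.sub_add_cancel hde]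
  · simp [wlenH, wtH]
    omega

end NS

open NS in
/-- For `d, e, f` with `e > 0` and positive words `w₁, w₂` in `x, y` containing together
exactly `d` occurrences of `x` and `f` occurrences of `y`, the word `w₁ τ x^e τ w₂`
evaluates to `x^d (x^τ)^e y^f` and is geodesic if and only if `e > d`. -/
theorem geodesic_w1_tau_xe_tau_w2_iff (d e f : ℕ) (he : 0 < e) (w₁ w₂ : Word GenH)
    (h₁ : ∀ p ∈ w₁, p = (GenH.x, true) ∨ p = (GenH.y, true))
    (h₂ : ∀ p ∈ w₂, p = (GenH.x, true) ∨ p = (GenH.y, true))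
    (hd : (w₁ ++ w₂).count (GenH.x, true) = d)
    (hf : (w₁ ++ w₂).count (GenH.y, true) = f) :
    evalH (w₁ ++ [(GenH.tau, true)] ++ List.replicate e (GenH.x, true) ++
        [(GenH.tau, true)] ++ w₂) = Hx ^ d * (cnj Hx Htau) ^ e * Hy ^ f ∧
    (IsGeodesicH (w₁ ++ [(GenH.tau, true)] ++ List.replicate e (GenH.x, true) ++
        [(GenH.tau, true)] ++ w₂) ↔ d < e) := by
  have hcd : w₁.count (GenH.x, true) + w₂.count (GenH.x, true) = d := by
    rw [← hd, List.count_append]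
  have hcf : w₁.count (GenH.y, true) + w₂.count (GenH.y, true) = f := by
    rw [← hf, List.count_append]
  obtain ⟨hw₁, hl₁⟩ := evalH_positive w₁ h₁
  obtain ⟨hw₂, hl₂⟩ := evalH_positive w₂ h₂
  have heval : evalH (w₁ ++ [(GenH.tau, true)] ++ List.replicate e (GenH.x, true) ++
      [(GenH.tau, true)] ++ w₂) = Hx ^ d * (cnj Hx Htau) ^ e * Hy ^ f := by
    simp only [evalH_append, evalH_replicate, evalH_cons, evalH_nil, if_true, mul_one, hw₁, hw₂]
    rw [← hcd, ← hcf]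
    generalize w₁.count (GenH.x, true) = p
    generalize w₁.count (GenH.y, true) = q
    generalize w₂.count (GenH.x, true) = r
    generalize w₂.count (GenH.y, true) = s
    change Hx ^ p * Hy ^ q * Htau * Hx ^ e * Htau * (Hx ^ r * Hy ^ s) = _
    calc _ = Hx ^ p * (Hy ^ q * (Htau * Hx ^ e * Htau) * Hx ^ r) * Hy ^ s := by
          simp only [mul_assoc]
      _ = Hx ^ p * (Hy ^ q * cnj Hx Htau ^ e * Hx ^ r) * Hy ^ s := by
          rw [cnj_pow_eq _ _ Htau_mul_self]
      _ = Hx ^ p * (Hx ^ r * cnj Hx Htau ^ e * Hy ^ q) * Hy ^ s := by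
          rw [(Hy_commute_cnj.pow_pow q e).eq, mul_assoc (_ ^ e), ← (Hx_commute_Hy.pow_pow r q).eq,
            ← mul_assoc (cnj Hx Htau ^ e), ← (Hx_commute_cnj.pow_pow r e).eq]
      _ = _ := by simp only [pow_add, mul_assoc]
  have hlen : wlenH (w₁ ++ [(GenH.tau, true)] ++ List.replicate e (GenH.x, true) ++
      [(GenH.tau, true)] ++ w₂) = d + e + f + 4 := by
    simp only [wlenH_append, hl₁, hl₂]
    simp [wlenH, wtH]
    omega
  refine ⟨heval, ?_⟩
  rw [isGeodesicH_iff, heval, hlen]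
  constructor
  · intro h
    by_contra hde
    obtain ⟨v, hv, hvl⟩ := exists_evalH_eq_of_le d e f (not_lt.1 hde)
    have := h v hv
    omega
  · intro hde v hv
    exact le_wlenH_of_evalH_eq d e f hde v hv
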